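/- Let P be a positive random field on X^{ℤ^d} and F a filtration. Let t ≠ s be points of ℤ^d and let x̄ ∈ 𝒳_{{t,s}}(F) be such that g_{{t,s}}^{x̄}(w) > 0 for all w ∈ X^{{t,s}}. Then for all x, u ∈ X^{{t}} and y, v ∈ X^{{s}} the boundary conditions x̄y, x̄v ∈ 𝒳_{{t}}(F) and x̄x, x̄u ∈ 𝒳_{{s}}(F), and g_t^{x̄y}(x) g_s^{x̄x}(v) g_t^{x̄v}(u) g_s^{x̄u}(y) = g_t^{x̄y}(u) g_s^{x̄u}(v) g_t^{x̄v}(x) g_s^{x̄x}(y). -/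

import Mathlib

open MeasureTheory Filter Topology

noncomputable section

/-- Sites of the lattice `ℤ^d`. -/
abbrev Site (d : ℕ) := Fin d → ℤ

/-- Configurations on the whole lattice. -/
abbrev Config (d : ℕ) (X : Type*) := Site d → X

variable {d : ℕ} {X : Type*}

/-- The configuration equal to `x` on `V` and to `z` off `V` (the concatenation `xz`). -/
def concat (V : Finset (Site d)) (x z : Config d X) : Config d X :=
  fun t => if t ∈ V then x t else z t

/-- The configuration equal to `u` on `I` and to `y` off `I`. -/
def extCfg (I : Finset (Site d)) (u : {s // s ∈ I} → X) (y : Config d X) : Config d X :=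
  fun t => if h : t ∈ I then u ⟨t, h⟩ else y t

/-- The cylinder set determined by the values of `z` on `Λ`. -/
def cyl (Λ : Finset (Site d)) (z : Config d X) : Set (Config d X) :=
  {ω | ∀ t ∈ Λ, ω t = z t}

/-- Finite-dimensional distribution `P_Λ(z)`. -/
def fdd [MeasurableSpace X] (P : Measure (Config d X)) (Λ : Finset (Site d))
    (z : Config d X) : ℝ :=
  (P (cyl Λ z)).toReal

/-- A positive random field: all finite-dimensional distributions are positive. -/
def IsPositiveRF [MeasurableSpace X] (P : Measure (Config d X)) : Prop :=
  ∀ Λ : Finset (Site d), Λ.Nonempty → ∀ z : Config d X, 0 < fdd P Λ z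

/-- Finite-conditional probability `g_V^z(x)` with boundary condition `z` on `Λ`. -/
def gfin [MeasurableSpace X] (P : Measure (Config d X)) (V Λ : Finset (Site d))
    (x z : Config d X) : ℝ :=
  fdd P (V ∪ Λ) (concat V x z) / fdd P Λ z

/-- A filtration: an increasing sequence of finite subsets of the lattice with union `ℤ^d`. -/
structure Filt (d : ℕ) where
  Λ : ℕ → Finset (Site d)
  mono : Monotone Λ
  covers : ∀ t : Site d, ∃ n, t ∈ Λ n

/-- The set `𝒳_V(F)` of admissible boundary conditions: those `x̄` for which all the limits
`lim_n g_V^{x̄_{Λ_n ∖ V}}(x)` exist. (Only the values of `x̄` off `V` are ever used.) -/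
def admissible [MeasurableSpace X] (P : Measure (Config d X)) (V : Finset (Site d))
    (F : Filt d) : Set (Config d X) :=
  {xb | ∀ x : Config d X, ∃ L : ℝ,
    Tendsto (fun n => gfin P V (F.Λ n \ V) x xb) atTop (𝓝 L)}

/-- The conditional probability `g_V^{x̄}(x)` : the limit of `g_V^{x̄_{Λ_n ∖ V}}(x)`. -/
def gCond [MeasurableSpace X] (P : Measure (Config d X)) (V : Finset (Site d))
    (F : Filt d) (xb x : Config d X) : ℝ :=
  limUnder atTop (fun n => gfin P V (F.Λ n \ V) x xb)

/-- Transition energy `Δ_V^{x̄}(x,u) = ln (g_V^{x̄}(x) / g_V^{x̄}(u))`. -/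
def TE [MeasurableSpace X] (P : Measure (Config d X)) (V : Finset (Site d))
    (F : Filt d) (xb x u : Config d X) : ℝ :=
  Real.log (gCond P V F xb x / gCond P V F xb u)

/-- Quasilocality (on boundary conditions off `V`) of a function `h` on a set `Y` of
boundary conditions. -/
def QuasilocalOn (V : Finset (Site d)) (Y : Set (Config d X)) (h : Config d X → ℝ) : Prop :=
  ∀ ε > 0, ∃ Λε : Finset (Site d), Disjoint Λε V ∧
    ∀ Λ : Finset (Site d), Disjoint Λ V → Λε ⊆ Λ →
      ∀ xb ∈ Y, ∀ yb ∈ Y, (∀ s ∈ Λ, xb s = yb s) → |h xb - h yb| < ε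

/-- `Y` represents a set of boundary conditions on `ℤ^d ∖ {t}`: membership does not depend
on the value at `t`. -/
def IsBCSet (t : Site d) (Y : Set (Config d X)) : Prop :=
  ∀ (ω : Config d X) (a : X), ω ∈ Y → Function.update ω t a ∈ Y

/-- `F` is a determining filtration for `P` with sets `Y t` of admissible boundary conditions:
the one-point finite-conditional probabilities converge, uniformly over `Y t`, to positive
limits, and `P(Y t) = 1`. -/
structure IsDetermining [MeasurableSpace X] (P : Measure (Config d X)) (F : Filt d)
    (Y : Site d → Set (Config d X)) : Prop where
  meas : ∀ t, MeasurableSet (Y t)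
  bc : ∀ t, IsBCSet t (Y t)
  adm : ∀ t, Y t ⊆ admissible P {t} F
  full : ∀ t, P (Y t) = 1
  pos : ∀ t, ∀ xb ∈ Y t, ∀ x : X, 0 < gCond P {t} F xb (fun _ => x)
  unif : ∀ (t : Site d) (x : X), ∀ ε > 0, ∃ N, ∀ n ≥ N, ∀ xb ∈ Y t,
    |gfin P {t} (F.Λ n \ {t}) (fun _ => x) xb - gCond P {t} F xb (fun _ => x)| < ε

/-- The probabilistic (Pr--) definition of a Gibbs random field. -/
def IsGibbsRF [MeasurableSpace X] (P : Measure (Config d X)) : Prop :=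
  IsProbabilityMeasure P ∧ IsPositiveRF P ∧
    ∃ (F : Filt d) (Y : Site d → Set (Config d X)), IsDetermining P F Y

theorem fdd_congr [MeasurableSpace X] (P : Measure (Config d X)) {Λ : Finset (Site d)}
    {z z' : Config d X} (h : ∀ r ∈ Λ, z r = z' r) : fdd P Λ z = fdd P Λ z' := by
  have hc : cyl Λ z = cyl Λ z' := by
    ext ω
    exact forall₂_congr fun r hr => by rw [h r hr]
  rw [fdd, hc, fdd]

theorem measurableSet_cyl [MeasurableSpace X] [MeasurableSingletonClass X]
    (Λ : Finset (Site d)) (z : Config d X) : MeasurableSet (cyl Λ z) := by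
  have hc : cyl Λ z = ⋂ r ∈ Λ, (fun ω : Config d X => ω r) ⁻¹' {z r} := by
    ext ω
    simp [cyl]
  rw [hc]
  exact Finset.measurableSet_biInter _ fun r _ =>
    measurable_pi_apply r (measurableSet_singleton (z r))

/-- Consistency of the finite-dimensional distributions: summing out one site. -/
theorem fdd_eq_sum_insert [Fintype X] [MeasurableSpace X] [MeasurableSingletonClass X]
    (P : Measure (Config d X)) [IsFiniteMeasure P] {Λ : Finset (Site d)} {t : Site d}
    (ht : t ∉ Λ) (z : Config d X) :
    fdd P Λ z = ∑ a, fdd P (insert t Λ) (Function.update z t a) := by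
  have hc : cyl Λ z = ⋃ a, cyl (insert t Λ) (Function.update z t a) := by
    ext ω
    simp only [cyl, Set.mem_ofPred_eq, Set.mem_iUnion, Finset.forall_mem_insert,
      Function.update_self]
    constructor
    · refine fun h => ⟨ω t, rfl, fun r hr => ?_⟩
      rw [Function.update_of_ne (ne_of_mem_of_not_mem hr ht), h r hr]
    · rintro ⟨a, -, h⟩ r hr
      rw [h r hr, Function.update_of_ne (ne_of_mem_of_not_mem hr ht)]
  have hd : Pairwise
      (Function.onFun Disjoint fun a => cyl (insert t Λ) (Function.update z t a)) := by
    refine fun a b hab => Set.disjoint_left.2 fun ω ha hb => hab ?_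
    have ha' := ha t (Finset.mem_insert_self t Λ)
    have hb' := hb t (Finset.mem_insert_self t Λ)
    rw [Function.update_self] at ha' hb'
    exact ha'.symm.trans hb'
  simp only [fdd]
  rw [hc, measure_iUnion hd fun a => measurableSet_cyl _ _, tsum_fintype,
    ENNReal.toReal_sum fun a _ => measure_ne_top _ _]

theorem IsPositiveRF.fdd_pos [MeasurableSpace X] {P : Measure (Config d X)}
    [IsProbabilityMeasure P] (hP : IsPositiveRF P) (Λ : Finset (Site d)) (z : Config d X) :
    0 < fdd P Λ z := by
  rcases Λ.eq_empty_or_nonempty with rfl | h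
  · simp [fdd, cyl]
  · exact hP Λ h z

theorem tendsto_gfin_gCond [MeasurableSpace X] {P : Measure (Config d X)}
    {V : Finset (Site d)} {F : Filt d} {xb : Config d X} (h : xb ∈ admissible P V F)
    (x : Config d X) :
    Tendsto (fun n => gfin P V (F.Λ n \ V) x xb) atTop (𝓝 (gCond P V F xb x)) :=
  tendsto_nhds_limUnder (h x)

/-- A one-point finite-conditional probability is obtained from the two-point ones by
normalization. -/
theorem gfin_singleton_eq_div_sum [Fintype X] [MeasurableSpace X] [MeasurableSingletonClass X]
    (P : Measure (Config d X)) [IsProbabilityMeasure P] (hP : IsPositiveRF P)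
    {Λ : Finset (Site d)} {t s : Site d} (ht : t ∈ Λ) (hs : s ∈ Λ)
    (xb x : Config d X) (y : X) :
    gfin P {t} (Λ \ {t}) x (Function.update xb s y) =
      gfin P {t, s} (Λ \ {t, s}) (Function.update (Function.update xb s y) t (x t)) xb /
        ∑ a, gfin P {t, s} (Λ \ {t, s})
          (Function.update (Function.update xb s y) t a) xb := by
  have h₁ : ({t} : Finset (Site d)) ∪ (Λ \ {t}) = Λ :=
    Finset.union_sdiff_of_subset (by simpa using ht)
  have h₂ : ({t, s} : Finset (Site d)) ∪ (Λ \ {t, s}) = Λ :=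
    Finset.union_sdiff_of_subset (by simp [Finset.insert_subset_iff, ht, hs])
  have h₃ : insert t (Λ \ {t}) = Λ := by rw [Finset.insert_eq, h₁]
  have hpair (a : X) : gfin P {t, s} (Λ \ {t, s})
      (Function.update (Function.update xb s y) t a) xb =
      fdd P Λ (Function.update (Function.update xb s y) t a) / fdd P (Λ \ {t, s}) xb := by
    rw [gfin, h₂]
    congr 1
    refine fdd_congr P fun r _ => ?_
    by_cases hrt : r = t <;> by_cases hrs : r = s <;> simp [concat, hrt, hrs]
  have hone : fdd P Λ (concat {t} x (Function.update xb s y)) =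
      fdd P Λ (Function.update (Function.update xb s y) t (x t)) := by
    refine fdd_congr P fun r _ => ?_
    by_cases hrt : r = t <;> simp [concat, hrt]
  simp only [hpair]
  have h₄ : t ∉ Λ \ {t} := Finset.notMem_sdiff_of_mem_right (Finset.mem_singleton_self t)
  rw [gfin, h₁, hone, fdd_eq_sum_insert P h₄, h₃, ← Finset.sum_div,
    div_div_div_cancel_right₀ (hP.fdd_pos _ _).ne']

/-- Under positive two-point conditional probabilities, the one-point finite-conditional
probabilities converge to the normalized two-point conditional probabilities. -/
theorem tendsto_gfin_singleton [Fintype X] [Nonempty X] [MeasurableSpace X]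
    [MeasurableSingletonClass X] (P : Measure (Config d X)) [IsProbabilityMeasure P]
    (hP : IsPositiveRF P) (F : Filt d) {t s : Site d} {xb : Config d X}
    (hxb : xb ∈ admissible P {t, s} F) (hpos : ∀ w : Config d X, 0 < gCond P {t, s} F xb w)
    (x : Config d X) (y : X) :
    Tendsto (fun n => gfin P {t} (F.Λ n \ {t}) x (Function.update xb s y)) atTop
      (𝓝 (gCond P {t, s} F xb (Function.update (Function.update xb s y) t (x t)) /
        ∑ a, gCond P {t, s} F xb (Function.update (Function.update xb s y) t a))) := by
  have hlim := (tendsto_gfin_gCond hxb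
    (Function.update (Function.update xb s y) t (x t))).div
    (tendsto_finsetSum Finset.univ fun a _ =>
      tendsto_gfin_gCond hxb (Function.update (Function.update xb s y) t a))
    (Finset.sum_pos (fun a _ => hpos _) Finset.univ_nonempty).ne'
  refine hlim.congr' ?_
  obtain ⟨n₁, h₁⟩ := F.covers t
  obtain ⟨n₂, h₂⟩ := F.covers s
  filter_upwards [eventually_ge_atTop n₁, eventually_ge_atTop n₂] with n hn₁ hn₂
  exact (gfin_singleton_eq_div_sum P hP (F.mono hn₁ h₁) (F.mono hn₂ h₂) xb x y).symm

/-- Proposition 2 / `admiss-1`. -/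
theorem stmt1 [Fintype X] [Nontrivial X] [MeasurableSpace X] [MeasurableSingletonClass X]
    (P : Measure (Config d X)) [IsProbabilityMeasure P] (hP : IsPositiveRF P)
    (F : Filt d) (t s : Site d) (hts : t ≠ s)
    (xb : Config d X) (hxb : xb ∈ admissible P {t, s} F)
    (hpos : ∀ w : Config d X, 0 < gCond P {t, s} F xb w) :
    (∀ y : X, Function.update xb s y ∈ admissible P {t} F) ∧
    (∀ x : X, Function.update xb t x ∈ admissible P {s} F) ∧
    ∀ x u y v : X,
      gCond P {t} F (Function.update xb s y) (fun _ => x) *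
          gCond P {s} F (Function.update xb t x) (fun _ => v) *
          gCond P {t} F (Function.update xb s v) (fun _ => u) *
          gCond P {s} F (Function.update xb t u) (fun _ => y) =
        gCond P {t} F (Function.update xb s y) (fun _ => u) *
          gCond P {s} F (Function.update xb t u) (fun _ => v) *
          gCond P {t} F (Function.update xb s v) (fun _ => x) *
          gCond P {s} F (Function.update xb t x) (fun _ => y) := by
  have hT := tendsto_gfin_singleton P hP F hxb hpos
  have hS := tendsto_gfin_singleton P hP F (Finset.pair_comm t s ▸ hxb)
    (Finset.pair_comm t s ▸ hpos)
  refine ⟨fun y x => ⟨_, hT x y⟩, fun x y => ⟨_, hS y x⟩, fun x u y v => ?_⟩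
  have hgT (a b : X) :
      gCond P {t} F (Function.update xb s b) (fun _ => a) = _ := (hT (fun _ => a) b).limUnder_eq
  have hgS (a b : X) :
      gCond P {s} F (Function.update xb t a) (fun _ => b) = _ := (hS (fun _ => b) a).limUnder_eq
  simp only [hgT, hgS, Finset.pair_comm s t, Function.update_comm hts.symm]
  ring
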